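/- Let p be a prime and n a positive integer with p ≥ 2n. Let 𝒢 be a subgroup of GL_n(Z_p), and let x be a nilpotent n×n matrix over F_p such that exp(x) := ∑_{i=0}^{n-1} x^i / i! lies in the image of 𝒢 under the reduction map GL_n(Z_p) → GL_n(F_p). Then for every integer k ≥ 1, x ∈ L_k(𝒢). -/

import Mathlib

/-- The truncated exponential `exp x = ∑_{i<n} x^i / i!` of an `n × n` matrix over `𝔽_p`. -/
noncomputable def truncExp (p n : ℕ) [Fact p.Prime]
    (x : Matrix (Fin n) (Fin n) (ZMod p)) : Matrix (Fin n) (Fin n) (ZMod p) :=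
  ∑ i ∈ Finset.range n, ((Nat.factorial i : ZMod p)⁻¹) • x ^ i

/-- For a subgroup `𝒢` of `GL_n(ℤ_p)` and `m ≥ 1`, `L_m(𝒢) ⊆ M_n(𝔽_p)` is the set of
reductions mod `p` of the matrices `(h - 1)/p^m`, as `h` ranges over the elements of `𝒢`
with `h ≡ 1 (mod p^m)`. -/
def Lm (p n : ℕ) [Fact p.Prime] (m : ℕ) (𝒢 : Subgroup (GL (Fin n) ℤ_[p])) :
    Set (Matrix (Fin n) (Fin n) (ZMod p)) :=
  {y | ∃ h ∈ 𝒢, ∃ M : Matrix (Fin n) (Fin n) ℤ_[p],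
    (h : Matrix (Fin n) (Fin n) ℤ_[p]) - 1 = ((p : ℤ_[p]) ^ m) • M ∧
      M.map (PadicInt.toZMod) = y}

open Polynomial in
/-- The polynomial `((1 + X) ^ p - 1 - X ^ p) / p`, a truncated logarithm modulo `p`. -/
noncomputable def truncLog (p : ℕ) (R : Type*) [CommRing R] : R[X] :=
  ∑ i ∈ Finset.Ico 1 p, ((p.choose i / p : ℕ) : R[X]) * X ^ i

lemma aeval_truncLog (p : ℕ) {R A : Type*} [CommRing R] [Ring A] [Algebra R A] (y : A) :
    Polynomial.aeval y (truncLog p R) =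
      ∑ i ∈ Finset.Ico 1 p, ((p.choose i / p : ℕ) : A) * y ^ i := by
  simp [truncLog]

lemma one_add_pow_prime {A : Type*} [Ring A] {p : ℕ} (hp : p.Prime) (y : A) :
    (1 + y) ^ p = 1 + p * ∑ i ∈ Finset.Ico 1 p, ((p.choose i / p : ℕ) : A) * y ^ i + y ^ p := by
  rw [add_comm 1 y, (Commute.one_right y).add_pow, Finset.sum_range_succ,
    Finset.range_eq_Ico, Finset.sum_eq_sum_Ico_succ_bot hp.pos, Finset.mul_sum]
  simp only [one_pow, mul_one, pow_zero, Nat.choose_zero_right, Nat.cast_one, Nat.choose_self,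
    zero_add]
  congr 2
  refine Finset.sum_congr rfl fun i hi => ?_
  rw [Finset.mem_Ico] at hi
  have h := Nat.mul_div_cancel' (hp.dvd_choose_self (by omega) hi.2)
  rw [← mul_assoc, ← Nat.cast_mul, h, Nat.cast_comm]

section ZModPolynomial

open Polynomial

variable (p : ℕ) [hp : Fact p.Prime]

lemma derivative_truncLog :
    derivative (truncLog p (ZMod p)) = (1 + X) ^ (p - 1) - X ^ (p - 1) := by
  have hp1 : p - 1 + 1 = p := Nat.sub_add_cancel hp.out.one_le
  rw [truncLog, Finset.sum_Ico_eq_sum_range, add_comm 1 X, (Commute.one_right X).add_pow,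
    Finset.sum_range_succ, derivative_sum]
  simp only [one_pow, mul_one, Nat.choose_self, Nat.cast_one, add_sub_cancel_right]
  refine Finset.sum_congr rfl fun j hj => ?_
  rw [Finset.mem_range] at hj
  have h1 := Nat.mul_div_cancel' (hp.out.dvd_choose_self (k := 1 + j) (by omega) (by omega))
  have h2 := Nat.add_one_mul_choose_eq (p - 1) j
  have h3 : (p.choose (1 + j) / p) * (1 + j) = (p - 1).choose j := by
    apply Nat.eq_of_mul_eq_mul_left hp.out.pos
    rw [← mul_assoc, h1]
    rw [hp1] at h2
    rw [h2, add_comm 1 j]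
  rw [derivative_mul, derivative_natCast, derivative_X_pow, zero_mul, zero_add, ← h3]
  simp
  ring

lemma one_add_X_mul_derivative_truncLog :
    (1 + X) * derivative (truncLog p (ZMod p)) = 1 - X ^ (p - 1) := by
  have h : ∀ q : (ZMod p)[X], q * q ^ (p - 1) = q ^ p := fun q => by
    rw [← pow_succ', Nat.sub_add_cancel hp.out.one_le]
  rw [derivative_truncLog, mul_sub, h, add_mul, h, add_pow_char, one_pow]
  ring

/-- The exponential series over `𝔽_p`, truncated in degree `p`. -/
noncomputable def expPoly : (ZMod p)[X] :=
  ∑ i ∈ Finset.range p, C ((i.factorial : ZMod p)⁻¹) * X ^ i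

lemma X_dvd_expPoly_sub_one : X ∣ expPoly p - 1 := by
  rw [X_dvd_iff, expPoly]
  simp [coeff_X_pow, hp.out.pos]

lemma X_pow_dvd_derivative_expPoly_sub :
    X ^ (p - 1) ∣ derivative (expPoly p) - expPoly p := by
  have hp1 : p = p - 1 + 1 := (Nat.sub_add_cancel hp.out.one_le).symm
  have key : derivative (expPoly p) =
      ∑ i ∈ Finset.range (p - 1), C ((i.factorial : ZMod p)⁻¹) * X ^ i := by
    rw [expPoly, congrArg Finset.range hp1, Finset.sum_range_succ', derivative_add, derivative_sum]
    simp only [pow_zero, mul_one, derivative_C, add_zero]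
    refine Finset.sum_congr rfl fun i hi => ?_
    rw [Finset.mem_range] at hi
    have hne : ((i + 1 : ℕ) : ZMod p) ≠ 0 := by
      rw [Ne, ZMod.natCast_eq_zero_iff]
      exact Nat.not_dvd_of_pos_of_lt (by omega) (by omega)
    rw [derivative_C_mul_X_pow, Nat.add_sub_cancel, Nat.factorial_succ, Nat.cast_mul, mul_inv,
      mul_right_comm, inv_mul_cancel₀ hne, one_mul]
  have h2 : expPoly p = (∑ i ∈ Finset.range (p - 1), C ((i.factorial : ZMod p)⁻¹) * X ^ i)
      + C (((p - 1).factorial : ZMod p)⁻¹) * X ^ (p - 1) := by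
    rw [← Finset.sum_range_succ, ← congrArg Finset.range hp1, expPoly]
  rw [key, h2, sub_add_cancel_left, dvd_neg]
  exact dvd_mul_left _ _

lemma X_pow_dvd_of_dvd_derivative {w : (ZMod p)[X]} (h0 : X ∣ w)
    (h : X ^ (p - 1) ∣ derivative w) : X ^ p ∣ w := by
  rw [X_pow_dvd_iff] at h ⊢
  rintro (_ | j) hj
  · exact X_dvd_iff.1 h0
  · have h1 := h j (by omega)
    rw [coeff_derivative] at h1
    refine (mul_eq_zero.1 h1).resolve_right ?_
    rw [← Nat.cast_succ, ZMod.natCast_eq_zero_iff]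
    exact Nat.not_dvd_of_pos_of_lt (by omega) hj

lemma X_pow_dvd_truncLog_comp_sub_X :
    X ^ p ∣ (truncLog p (ZMod p)).comp (expPoly p - 1) - X := by
  set f := expPoly p
  have hXf : X ∣ f - 1 := X_dvd_expPoly_sub_one p
  apply X_pow_dvd_of_dvd_derivative
  · refine dvd_sub (hXf.trans ?_) dvd_rfl
    rw [truncLog, Polynomial.sum_comp]
    refine Finset.dvd_sum fun i hi => ?_
    rw [mul_comp, X_pow_comp]
    exact Dvd.dvd.mul_left (dvd_pow_self _ (by simp at hi; omega)) _
  · have hcop : IsCoprime (X ^ (p - 1)) f := by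
      apply IsCoprime.pow_left
      obtain ⟨q, hq⟩ := hXf
      exact ⟨-q, 1, by linear_combination hq⟩
    refine hcop.dvd_of_dvd_mul_left ?_
    have h1 : f * (derivative (truncLog p (ZMod p))).comp (f - 1) = 1 - (f - 1) ^ (p - 1) := by
      have := congrArg (fun q => q.comp (f - 1)) (one_add_X_mul_derivative_truncLog p)
      simpa using this
    have h2 : f * derivative ((truncLog p (ZMod p)).comp (f - 1) - X) =
        (derivative f - f) - (f - 1) ^ (p - 1) * derivative f := by
      rw [derivative_sub, derivative_comp, derivative_X, derivative_sub, derivative_one, sub_zero]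
      linear_combination derivative f * h1
    rw [h2]
    exact dvd_sub (X_pow_dvd_derivative_expPoly_sub p) ((pow_dvd_pow_of_dvd hXf _).mul_right _)

lemma aeval_truncLog_expPoly {A : Type*} [Ring A] [Algebra (ZMod p) A] {x : A}
    (hx : x ^ p = 0) : aeval (aeval x (expPoly p) - 1) (truncLog p (ZMod p)) = x := by
  obtain ⟨q, hq⟩ := X_pow_dvd_truncLog_comp_sub_X p
  have := congrArg (aeval x) hq
  simpa [aeval_comp, hx, sub_eq_zero] using this

lemma pow_eq_zero_aeval_expPoly_sub_one {A : Type*} [Ring A] [Algebra (ZMod p) A] {x : A} {n : ℕ}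
    (hx : x ^ n = 0) : (aeval x (expPoly p) - 1) ^ n = 0 := by
  obtain ⟨q, hq⟩ := pow_dvd_pow_of_dvd (X_dvd_expPoly_sub_one p) n
  have := congrArg (aeval x) hq
  simpa [hx] using this

end ZModPolynomial

lemma Matrix.pow_card_eq_zero_of_isNilpotent {ι K : Type*} [Fintype ι] [DecidableEq ι] [Field K]
    {x : Matrix ι ι K} (hx : IsNilpotent x) : x ^ Fintype.card ι = 0 := by
  have h := Matrix.isNilpotent_charpoly_sub_pow_of_isNilpotent hx
  have h1 := x.aeval_self_charpoly
  rw [sub_eq_zero.1 h.eq_zero] at h1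
  simpa using h1

lemma truncExp_eq_aeval (p n : ℕ) [hp : Fact p.Prime] (hnp : n ≤ p)
    {x : Matrix (Fin n) (Fin n) (ZMod p)} (hx : x ^ n = 0) :
    truncExp p n x = Polynomial.aeval x (expPoly p) := by
  rw [truncExp, expPoly, map_sum]
  refine Finset.sum_subset_zero_on_sdiff (Finset.range_subset_range.2 hnp) (fun i hi => ?_)
    fun i _ => ?_
  · simp only [Finset.mem_sdiff, Finset.mem_range, not_lt] at hi
    simp [pow_eq_zero_of_le hi.2 hx]
  · simp [Algebra.smul_def]

lemma PadicInt.exists_eq_smul_of_map_toZMod_eq_zero {p : ℕ} [Fact p.Prime] {ι : Type*}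
    {A : Matrix ι ι ℤ_[p]} (h : A.map PadicInt.toZMod = 0) :
    ∃ B : Matrix ι ι ℤ_[p], A = (p : ℤ_[p]) • B := by
  have h1 : ∀ i j, ∃ b, A i j = p * b := fun i j => by
    have : A i j ∈ RingHom.ker (PadicInt.toZMod (p := p)) := congrFun (congrFun h i) j
    rw [PadicInt.ker_toZMod, PadicInt.maximalIdeal_eq_span_p, Ideal.mem_span_singleton] at this
    exact this
  choose B hB using h1
  exact ⟨Matrix.of B, by ext i j : 2; simpa using hB i j⟩

section Lm

variable {p n : ℕ} [hp : Fact p.Prime] {𝒢 : Subgroup (GL (Fin n) ℤ_[p])}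
  {x : Matrix (Fin n) (Fin n) (ZMod p)}

/-- A lift of `exp x` has `p`-th power congruent to `1 + p x` modulo `p ^ 2`. -/
lemma mem_Lm_one (hpn : 2 * n ≤ p) (hx : x ^ n = 0)
    (hlift : ∃ g ∈ 𝒢, ((g : Matrix (Fin n) (Fin n) ℤ_[p])).map (PadicInt.toZMod) =
      truncExp p n x) : x ∈ Lm p n 1 𝒢 := by
  obtain ⟨g, hg, hgx⟩ := hlift
  rw [truncExp_eq_aeval p n (by omega) hx] at hgx
  set φ := (PadicInt.toZMod (p := p)).mapMatrix (m := Fin n)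
  set N : Matrix (Fin n) (Fin n) ℤ_[p] := g - 1 with hN
  have hφN : φ N = Polynomial.aeval x (expPoly p) - 1 := by
    rw [hN, map_sub, map_one, ← hgx]; rfl
  obtain ⟨A, hA⟩ : ∃ A, N ^ n = (p : ℤ_[p]) • A :=
    PadicInt.exists_eq_smul_of_map_toZMod_eq_zero <| by
      change φ (N ^ n) = 0
      rw [map_pow, hφN, pow_eq_zero_aeval_expPoly_sub_one p hx]
  have hNp : N ^ p = (p : ℤ_[p]) • ((p : ℤ_[p]) • (A * A * N ^ (p - 2 * n))) := by
    rw [← pow_mul_pow_sub N hpn, two_mul, pow_add, hA]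
    simp [smul_smul]
  refine ⟨g ^ p, pow_mem hg p, (∑ i ∈ Finset.Ico 1 p, ((p.choose i / p : ℕ) :
    Matrix (Fin n) (Fin n) ℤ_[p]) * N ^ i) + (p : ℤ_[p]) • (A * A * N ^ (p - 2 * n)), ?_, ?_⟩
  · have : (g : Matrix (Fin n) (Fin n) ℤ_[p]) = 1 + N := by rw [hN]; abel
    rw [Units.val_pow_eq_pow_val, this, one_add_pow_prime hp.out, hNp, pow_one, smul_add,
      ← nsmul_eq_mul, ← Nat.cast_smul_eq_nsmul ℤ_[p]]
    abel
  · change φ _ = x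
    have h0 : φ ((p : ℤ_[p]) • (A * A * N ^ (p - 2 * n))) = 0 := by
      rw [Nat.cast_smul_eq_nsmul, map_nsmul, ← Nat.cast_smul_eq_nsmul (ZMod p)]
      simp
    rw [map_add, h0, add_zero, map_sum]
    simp only [map_mul, map_natCast, map_pow, hφN]
    rw [← aeval_truncLog (R := ZMod p), aeval_truncLog_expPoly]
    exact pow_eq_zero_of_le (by omega) hx

/-- For odd `p`, taking `p`-th powers maps `1 + p ^ k M` to `1 + p ^ (k + 1) M` modulo
`p ^ (k + 2)`. -/
lemma mem_Lm_succ (hp3 : 3 ≤ p) {k : ℕ} (hk : 1 ≤ k) (h : x ∈ Lm p n k 𝒢) :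
    x ∈ Lm p n (k + 1) 𝒢 := by
  obtain ⟨g, hg, M, hM, rfl⟩ := h
  set S := ∑ i ∈ Finset.Ico 2 p, ((p.choose i / p : ℕ) : Matrix (Fin n) (Fin n) ℤ_[p]) *
    (((p : ℤ_[p]) ^ (k * i - (k + 1))) • M ^ i) with hS
  set φ := (PadicInt.toZMod (p := p)).mapMatrix (m := Fin n)
  refine ⟨g ^ p, pow_mem hg p,
    M + (p : ℤ_[p]) • (S + ((p : ℤ_[p]) ^ (k * p - (k + 2))) • M ^ p), ?_, ?_⟩
  · have hexp : ∀ i, 2 ≤ i → k + 1 ≤ k * i := fun i hi => by nlinarith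
    have hexp' : k + 2 ≤ k * p := by nlinarith
    have hsum : ∑ i ∈ Finset.Ico 2 p, ((p.choose i / p : ℕ) : Matrix (Fin n) (Fin n) ℤ_[p]) *
        ((p : ℤ_[p]) ^ k • M) ^ i = (p : ℤ_[p]) ^ (k + 1) • S := by
      rw [hS, Finset.smul_sum]
      refine Finset.sum_congr rfl fun i hi => ?_
      rw [smul_pow, ← pow_mul, ← mul_smul_comm, smul_smul, ← pow_add,
        Nat.add_sub_cancel' (hexp i (Finset.mem_Ico.1 hi).1)]
    have hlast : ((p : ℤ_[p]) ^ k • M) ^ p =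
        (p : ℤ_[p]) ^ (k + 2) • ((p : ℤ_[p]) ^ (k * p - (k + 2))) • M ^ p := by
      rw [smul_pow, ← pow_mul, smul_smul, ← pow_add, Nat.add_sub_cancel' hexp']
    rw [Units.val_pow_eq_pow_val, ← add_sub_cancel 1 (g : Matrix (Fin n) (Fin n) ℤ_[p]), hM,
      one_add_pow_prime hp.out, Finset.sum_eq_sum_Ico_succ_bot (by omega), hsum, hlast,
      Nat.choose_one_right, Nat.div_self hp.out.pos, ← nsmul_eq_mul,
      ← Nat.cast_smul_eq_nsmul ℤ_[p]]
    simp only [Nat.cast_one, one_mul, pow_one]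
    module
  · change φ _ = φ M
    rw [map_add, Nat.cast_smul_eq_nsmul, map_nsmul, ← Nat.cast_smul_eq_nsmul (ZMod p)]
    simp

end Lm

/-- Let `p ≥ 2n` be prime, `𝒢 ≤ GL_n(ℤ_p)`, and `x` a nilpotent `n × n` matrix over `𝔽_p`
such that `exp x` lies in the mod-`p` reduction of `𝒢`.  Then `x ∈ L_k(𝒢)` for all
`k ≥ 1`. -/
theorem nilpotent_mem_Lk (p n : ℕ) [hp : Fact p.Prime] (hn : 0 < n) (hpn : 2 * n ≤ p)
    (𝒢 : Subgroup (GL (Fin n) ℤ_[p]))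
    (x : Matrix (Fin n) (Fin n) (ZMod p)) (hx : IsNilpotent x)
    (hlift : ∃ g ∈ 𝒢, ((g : Matrix (Fin n) (Fin n) ℤ_[p])).map (PadicInt.toZMod) =
      truncExp p n x) :
    ∀ k : ℕ, 1 ≤ k → x ∈ Lm p n k 𝒢 := by
  have hxn : x ^ n = 0 := by simpa using Matrix.pow_card_eq_zero_of_isNilpotent hx
  intro k hk
  obtain rfl | hn2 : n = 1 ∨ 2 ≤ n := by omega
  · rw [pow_one] at hxn
    exact ⟨1, one_mem _, 0, by simp, by simp [hxn]⟩
  · induction k, hk using Nat.le_induction with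
    | base => exact mem_Lm_one hpn hxn hlift
    | succ k hk ih => exact mem_Lm_succ (by omega) hk ih
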